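/- arXiv:2505.04077 — 3 statements merged into one kernel-verified Lean document; each statement's English description precedes it below -/
import Mathlib

section
/- Let d ≥ 1, let 0 < ε < d, and let 0 < a ≤ b satisfy b + ε > d and b ≠ d. Then there is a constant C depending only on a, b, ε, d such that for all n, n' ∈ ℤ^d, the sum over n₁ ∈ ℤ^d of 1/(|n - n₁|^a · |n₁|^ε · |n₁ - n'|^b) is at most C / (|n - n'|^a · (min{|n|,|n'|})^min{ε, a, ε+b-d}), where |m| = max(‖m‖_∞, 1). -/
/-- For `n ∈ ℤ^d`, `|n| = max(‖n‖_∞, 1)`. -/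
noncomputable def znorm {d : ℕ} (n : Fin d → ℤ) : ℝ :=
  max ((Finset.univ.sup fun i => (n i).natAbs : ℕ) : ℝ) 1

/-- The sup-norm ball of radius `2 ^ l` in `ℤ^d`. -/
noncomputable def dyadicBox (d l : ℕ) : Finset (Fin d → ℤ) :=
  Finset.Icc (fun _ => -(2 ^ l : ℤ)) (fun _ => (2 ^ l : ℤ))

lemma one_le_znorm {d : ℕ} (n : Fin d → ℤ) : 1 ≤ znorm n := le_max_right _ _

lemma znorm_pos {d : ℕ} (n : Fin d → ℤ) : 0 < znorm n :=
  one_pos.trans_le (one_le_znorm n)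

lemma znorm_le_iff {d : ℕ} (n : Fin d → ℤ) {r : ℝ} (hr : 1 ≤ r) :
    znorm n ≤ r ↔ ∀ i, |(n i : ℝ)| ≤ r := by
  have h0 : 0 ≤ r := zero_le_one.trans hr
  have hcast : ∀ i, (((n i).natAbs : ℕ) : ℝ) = |(n i : ℝ)| := fun i => by
    rw [Nat.cast_natAbs]; push_cast; rfl
  unfold znorm
  rw [max_le_iff, and_iff_left hr, ← Nat.le_floor_iff h0, Finset.sup_le_iff]
  simp only [Finset.mem_univ, true_imp_iff, Nat.le_floor_iff h0, hcast]

lemma abs_le_znorm {d : ℕ} (n : Fin d → ℤ) (i : Fin d) : |(n i : ℝ)| ≤ znorm n :=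
  (znorm_le_iff n (one_le_znorm n)).1 le_rfl i

lemma znorm_neg {d : ℕ} (n : Fin d → ℤ) : znorm (-n) = znorm n := by
  simp [znorm]

lemma znorm_sub_comm {d : ℕ} (m n : Fin d → ℤ) : znorm (m - n) = znorm (n - m) := by
  rw [← znorm_neg, neg_sub]

lemma znorm_add_le {d : ℕ} (m n : Fin d → ℤ) : znorm (m + n) ≤ znorm m + znorm n := by
  rw [znorm_le_iff _ (by linarith [one_le_znorm m, one_le_znorm n])]
  intro i
  have := abs_add_le (m i : ℝ) (n i : ℝ)
  have := abs_le_znorm m i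
  have := abs_le_znorm n i
  simp only [Pi.add_apply, Int.cast_add]
  linarith

lemma znorm_sub_le {d : ℕ} (u m v : Fin d → ℤ) :
    znorm (u - v) ≤ znorm (m - u) + znorm (m - v) := by
  have := znorm_add_le (u - m) (m - v)
  rwa [sub_add_sub_cancel, znorm_sub_comm u m] at this

lemma mem_dyadicBox {d l : ℕ} {n : Fin d → ℤ} : n ∈ dyadicBox d l ↔ znorm n ≤ 2 ^ l := by
  rw [znorm_le_iff n (one_le_pow₀ one_le_two), dyadicBox, Finset.mem_Icc, Pi.le_def, Pi.le_def,
    ← forall_and]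
  refine forall_congr' fun i => ?_
  rw [← abs_le]
  exact_mod_cast Iff.rfl

lemma card_dyadicBox_le (d l : ℕ) : ((dyadicBox d l).card : ℝ) ≤ 3 ^ d * (2 ^ l) ^ d := by
  have h : (dyadicBox d l).card ≤ (3 * 2 ^ l) ^ d := by
    rw [dyadicBox, Pi.card_Icc]
    simp only [Int.card_Icc, Finset.prod_const, Finset.card_univ, Fintype.card_fin]
    refine Nat.pow_le_pow_left ?_ d
    have : (1 : ℤ) ≤ 2 ^ l := one_le_pow₀ (by norm_num)
    zify
    rw [Int.toNat_of_nonneg (by linarith)]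
    linarith
  rw [← mul_pow]
  exact_mod_cast h

/-- A partial geometric sum with ratio `2 ^ t`, `t ≠ 0`, is dominated by its largest term. -/
lemma exists_geom_sum_two_rpow_le {t : ℝ} (ht : t ≠ 0) :
    ∃ C : ℝ, 0 < C ∧ ∀ l : ℕ,
      ∑ p ∈ Finset.range (l + 1), ((2 : ℝ) ^ t) ^ p ≤ C * ((2 : ℝ) ^ max 0 t) ^ l := by
  rcases lt_or_gt_of_ne ht with h | h
  · have hx : (2 : ℝ) ^ t < 1 := Real.rpow_lt_one_of_one_lt_of_neg one_lt_two h
    have hx0 : (0 : ℝ) < 2 ^ t := by positivity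
    refine ⟨1 / (1 - 2 ^ t), by rw [one_div]; exact inv_pos.2 (by linarith), fun l => ?_⟩
    rw [max_eq_left h.le, Real.rpow_zero, one_pow, mul_one, Finset.range_eq_Ico]
    simpa using geom_sum_Ico_le_of_lt_one (m := 0) (n := l + 1) hx0.le hx
  · have hx : 1 < (2 : ℝ) ^ t := Real.one_lt_rpow one_lt_two h
    have hx1 : 0 < (2 : ℝ) ^ t - 1 := by linarith
    refine ⟨2 ^ t / (2 ^ t - 1), by positivity, fun l => ?_⟩
    rw [max_eq_right h.le, geom_sum_eq hx.ne', div_mul_eq_mul_div, ← pow_succ']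
    gcongr
    linarith

lemma two_rpow_pow (s : ℝ) (l : ℕ) : ((2 : ℝ) ^ s) ^ l = ((2 : ℝ) ^ l) ^ s := by
  rw [← Real.rpow_natCast, ← Real.rpow_natCast, ← Real.rpow_mul zero_le_two,
    ← Real.rpow_mul zero_le_two, mul_comm]

lemma sum_dyadicBox_rpow_le_geom (d : ℕ) {β : ℝ} (hβ : 0 < β) (l : ℕ) :
    ∑ m ∈ dyadicBox d l, znorm m ^ (-β) ≤
      3 ^ d * 2 ^ β * ∑ p ∈ Finset.range (l + 1), ((2 : ℝ) ^ (d - β)) ^ p := by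
  have hstep : ∀ p : ℕ, ((2 : ℝ) ^ p) ^ d * ((2 : ℝ) ^ p) ^ (-β) = ((2 : ℝ) ^ (d - β)) ^ p := by
    intro p
    rw [two_rpow_pow, ← Real.rpow_natCast _ d, ← Real.rpow_add (by positivity), sub_eq_add_neg]
  induction l with
  | zero =>
    have h1 : ∑ m ∈ dyadicBox d 0, znorm m ^ (-β) ≤ ∑ m ∈ dyadicBox d 0, (1 : ℝ) :=
      Finset.sum_le_sum fun m _ =>
        Real.rpow_le_one_of_one_le_of_nonpos (one_le_znorm m) (by linarith)
    have h2 := card_dyadicBox_le d 0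
    have h3 : (1 : ℝ) ≤ 2 ^ β := Real.one_le_rpow one_le_two hβ.le
    have h4 : (0 : ℝ) < 3 ^ d := by positivity
    simp only [Finset.sum_const, nsmul_eq_mul, mul_one, pow_zero, one_pow] at h1 h2
    simp only [zero_add, Finset.range_one, Finset.sum_singleton, pow_zero, mul_one]
    nlinarith
  | succ l ih =>
    have hsub : dyadicBox d l ⊆ dyadicBox d (l + 1) := fun m hm =>
      mem_dyadicBox.2 ((mem_dyadicBox.1 hm).trans
        (pow_le_pow_right₀ one_le_two (Nat.le_succ l)))
    rw [← Finset.sum_sdiff hsub, Finset.sum_range_succ, mul_add, add_comm]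
    refine add_le_add ih ?_
    calc ∑ m ∈ dyadicBox d (l + 1) \ dyadicBox d l, znorm m ^ (-β)
        ≤ ∑ m ∈ dyadicBox d (l + 1) \ dyadicBox d l, ((2 : ℝ) ^ l) ^ (-β) := by
          refine Finset.sum_le_sum fun m hm => ?_
          rw [Finset.mem_sdiff, mem_dyadicBox, mem_dyadicBox, not_le] at hm
          exact Real.rpow_le_rpow_of_nonpos (by positivity) hm.2.le (by linarith)
      _ ≤ ∑ m ∈ dyadicBox d (l + 1), ((2 : ℝ) ^ l) ^ (-β) :=
          Finset.sum_le_sum_of_subset_of_nonneg Finset.sdiff_subset fun _ _ _ => by positivity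
      _ = (dyadicBox d (l + 1)).card * ((2 : ℝ) ^ l) ^ (-β) := by
          rw [Finset.sum_const, nsmul_eq_mul]
      _ ≤ (3 ^ d * (2 ^ (l + 1)) ^ d) * ((2 : ℝ) ^ l) ^ (-β) := by
          gcongr
          exact card_dyadicBox_le d (l + 1)
      _ = 3 ^ d * 2 ^ β * ((2 : ℝ) ^ ((d : ℝ) - β)) ^ (l + 1) := by
          have h2 : (2 : ℝ) ^ d = 2 ^ β * 2 ^ ((d : ℝ) - β) := by
            rw [← Real.rpow_add two_pos, add_sub_cancel, Real.rpow_natCast]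
          rw [pow_succ ((2 : ℝ) ^ ((d : ℝ) - β)), ← hstep l, pow_succ (2 : ℝ) l, mul_pow, h2]
          ring

lemma exists_sum_dyadicBox_rpow_le (d : ℕ) {β : ℝ} (hβ : 0 < β) (hβd : β ≠ d) :
    ∃ C : ℝ, 0 < C ∧ ∀ l : ℕ, ∑ m ∈ dyadicBox d l, znorm m ^ (-β) ≤
      C * ((2 : ℝ) ^ max 0 (d - β)) ^ l := by
  obtain ⟨C, hC, h⟩ := exists_geom_sum_two_rpow_le (sub_ne_zero.2 hβd.symm)
  refine ⟨3 ^ d * 2 ^ β * C, by positivity, fun l => ?_⟩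
  refine (sum_dyadicBox_rpow_le_geom d hβ l).trans ?_
  rw [mul_assoc (3 ^ d * 2 ^ β)]
  exact mul_le_mul_of_nonneg_left (h l) (by positivity)

lemma exists_dyadic_near {d : ℕ} (m : Fin d → ℤ) :
    ∃ l : ℕ, znorm m ≤ 2 ^ l ∧ 2 ^ l ≤ 2 * znorm m := by
  obtain ⟨l, h1, h2⟩ := exists_nat_pow_near (one_le_znorm m) one_lt_two
  exact ⟨l + 1, h2.le, by rw [pow_succ']; linarith⟩

/-- The part of the convolution sum where the point `m` is closer to `v` than to `u`. -/
lemma exists_sum_filter_closer_le (d : ℕ) {α β : ℝ} (hα : 0 < α) (hβ : 0 < β) (hβd : β ≠ d)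
    (hαβ : d < α + β) :
    ∃ C : ℝ, 0 < C ∧ ∀ (u v : Fin d → ℤ) (s : Finset (Fin d → ℤ)),
      ∑ m ∈ s with znorm (m - v) ≤ znorm (m - u), znorm (m - u) ^ (-α) * znorm (m - v) ^ (-β) ≤
        C * znorm (u - v) ^ (-min α (α + β - d)) := by
  obtain ⟨C₁, hC₁, hF⟩ := exists_sum_dyadicBox_rpow_le d hβ hβd
  set γ : ℝ := max 0 (d - β) with hγ
  have hδγ : min α (α + β - d) = α - γ := by
    rw [hγ, ← min_sub_sub_left, sub_zero]; congr 1; ring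
  rw [hδγ]
  have hδ : 0 < α - γ := by rw [← hδγ]; exact lt_min hα (by linarith)
  set δ : ℝ := α - γ with hδ_def
  have hx : (2 : ℝ) ^ (-δ) < 1 := Real.rpow_lt_one_of_one_lt_of_neg one_lt_two (by linarith)
  have hx' : 0 < 1 - (2 : ℝ) ^ (-δ) := by linarith
  refine ⟨2 ^ α * C₁ * (2 ^ δ / (1 - 2 ^ (-δ))), by positivity, fun u v s => ?_⟩
  choose e he₁ he₂ using exists_dyadic_near (d := d)
  have hex : ∃ l : ℕ, znorm (u - v) ≤ 2 * 2 ^ l :=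
    ⟨e (u - v), by linarith [he₁ (u - v), znorm_pos (u - v)]⟩
  classical
  obtain ⟨L, hL, hLmin⟩ : ∃ L : ℕ, znorm (u - v) ≤ 2 * 2 ^ L ∧
      ∀ l : ℕ, znorm (u - v) ≤ 2 * 2 ^ l → L ≤ l :=
    ⟨Nat.find hex, Nat.find_spec hex, fun l hl => Nat.find_min' hex hl⟩
  set N := s.sup (fun m => e (m - u)) + 1 with hN
  set t := s.filter fun m => znorm (m - v) ≤ znorm (m - u) with ht
  have hmaps : ∀ m ∈ t, e (m - u) ∈ Finset.Ico L N := by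
    intro m hm
    rw [ht, Finset.mem_filter] at hm
    rw [Finset.mem_Ico]
    refine ⟨hLmin _ ?_, Nat.lt_succ_of_le (Finset.le_sup (f := fun m => e (m - u)) hm.1)⟩
    linarith [znorm_sub_le u m v, he₁ (m - u), hm.2]
  have hlayer : ∀ p : ℕ, ∑ m ∈ t with e (m - u) = p,
      znorm (m - u) ^ (-α) * znorm (m - v) ^ (-β) ≤ 2 ^ α * C₁ * ((2 : ℝ) ^ (-δ)) ^ p := by
    intro p
    have hpt : ∀ m ∈ t.filter fun m => e (m - u) = p,
        znorm (m - u) ^ (-α) * znorm (m - v) ^ (-β) ≤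
          2 ^ α * ((2 : ℝ) ^ p) ^ (-α) * znorm (m - v) ^ (-β) := by
      intro m hm
      rw [Finset.mem_filter] at hm
      have h1 := he₂ (m - u)
      rw [hm.2] at h1
      have h2 : znorm (m - u) ^ (-α) ≤ ((2 : ℝ) ^ p / 2) ^ (-α) :=
        Real.rpow_le_rpow_of_nonpos (by positivity) (by linarith) (by linarith)
      rw [Real.div_rpow (by positivity) zero_le_two, Real.rpow_neg zero_le_two α,
        div_inv_eq_mul, mul_comm] at h2
      exact mul_le_mul_of_nonneg_right h2 (Real.rpow_nonneg (znorm_pos _).le _)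
    refine (Finset.sum_le_sum hpt).trans ?_
    rw [← Finset.mul_sum]
    have hinj : Set.InjOn (fun m : Fin d → ℤ => m - v)
        (t.filter fun m => e (m - u) = p : Finset (Fin d → ℤ)) :=
      fun _ _ _ _ h => sub_left_injective h
    have hsub : (t.filter fun m => e (m - u) = p).image (fun m => m - v) ⊆ dyadicBox d p := by
      intro j hj
      obtain ⟨m, hm, rfl⟩ := Finset.mem_image.1 hj
      rw [Finset.mem_filter, ht, Finset.mem_filter] at hm
      have h1 := he₁ (m - u)
      rw [hm.2] at h1
      exact mem_dyadicBox.2 (hm.1.2.trans h1)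
    have hsum : ∑ m ∈ t with e (m - u) = p, znorm (m - v) ^ (-β) ≤ C₁ * ((2 : ℝ) ^ γ) ^ p := by
      rw [← Finset.sum_image (f := fun j => znorm j ^ (-β)) hinj]
      exact (Finset.sum_le_sum_of_subset_of_nonneg hsub fun j _ _ =>
        Real.rpow_nonneg (znorm_pos j).le _).trans (hF p)
    refine (mul_le_mul_of_nonneg_left hsum (by positivity)).trans_eq ?_
    have hexp : ((2 : ℝ) ^ (-δ)) ^ p = ((2 : ℝ) ^ p) ^ (-α) * ((2 : ℝ) ^ γ) ^ p := by
      rw [two_rpow_pow, two_rpow_pow, ← Real.rpow_add (by positivity), hδ_def]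
      congr 1; ring
    rw [hexp]
    ring
  rw [← Finset.sum_fiberwise_of_maps_to hmaps]
  refine (Finset.sum_le_sum fun p _ => hlayer p).trans ?_
  rw [← Finset.mul_sum, mul_assoc (2 ^ α * C₁)]
  refine mul_le_mul_of_nonneg_left ?_ (by positivity)
  refine (geom_sum_Ico_le_of_lt_one (by positivity) hx).trans ?_
  rw [div_mul_eq_mul_div]
  gcongr
  have h3 : ((2 : ℝ) ^ L) ^ (-δ) ≤ (znorm (u - v) / 2) ^ (-δ) :=
    Real.rpow_le_rpow_of_nonpos (half_pos (znorm_pos _)) (by linarith) (by linarith)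
  rw [Real.div_rpow (znorm_pos _).le zero_le_two, Real.rpow_neg zero_le_two δ,
    div_inv_eq_mul, mul_comm] at h3
  rwa [two_rpow_pow]

/-- Convolution estimate for two powers of `znorm`. -/
lemma exists_sum_rpow_mul_rpow_le (d : ℕ) {ε b : ℝ} (hε0 : 0 < ε) (hεd : ε < d) (hb : 0 < b)
    (hbe : d < b + ε) (hbd : b ≠ d) :
    ∃ C : ℝ, 0 < C ∧ ∀ (k : Fin d → ℤ) (s : Finset (Fin d → ℤ)),
      ∑ m ∈ s, znorm m ^ (-ε) * znorm (m - k) ^ (-b) ≤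
        C * znorm k ^ (-min ε (ε + b - d)) := by
  obtain ⟨C₁, hC₁, h₁⟩ := exists_sum_filter_closer_le d hε0 hb hbd (by linarith)
  obtain ⟨C₂, hC₂, h₂⟩ := exists_sum_filter_closer_le d hb hε0 hεd.ne hbe
  refine ⟨C₁ + C₂, by positivity, fun k s => ?_⟩
  have H₁ := h₁ 0 k s
  have H₂ := h₂ k 0 s
  simp only [sub_zero, zero_sub, znorm_neg] at H₁ H₂
  have hexp : znorm k ^ (-min b (b + ε - d)) ≤ znorm k ^ (-min ε (ε + b - d)) := by
    refine Real.rpow_le_rpow_of_exponent_le (one_le_znorm k) (neg_le_neg ?_)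
    rw [min_eq_right (a := b) (by linarith), add_comm b]
    exact min_le_right _ _
  rw [← Finset.sum_filter_add_sum_filter_not s fun m => znorm (m - k) ≤ znorm m, add_mul]
  refine add_le_add H₁ (le_trans ?_ (H₂.trans (mul_le_mul_of_nonneg_left hexp hC₂.le)))
  simp_rw [mul_comm (znorm _ ^ (-ε))]
  refine Finset.sum_le_sum_of_subset_of_nonneg (fun m hm => ?_) fun m _ _ =>
    mul_nonneg (Real.rpow_nonneg (znorm_pos _).le _) (Real.rpow_nonneg (znorm_pos _).le _)
  rw [Finset.mem_filter] at hm ⊢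
  exact ⟨hm.1, (not_le.1 hm.2).le⟩

/-- If `N ≤ A + B`, one of the two factors `A ^ a`, `B ^ b` absorbs `N ^ a`. -/
lemma rpow_neg_mul_rpow_neg_le {N A B a b : ℝ} (hN : 0 < N) (hA : 0 < A) (hB : 0 < B)
    (ha : 0 < a) (hab : a ≤ b) (h : N ≤ A + B) :
    A ^ (-a) * B ^ (-b) ≤ 2 ^ a * N ^ (-a) * (B ^ (-b) + A ^ (-b)) := by
  have key : ∀ x : ℝ, 0 < x → N ≤ 2 * x → x ^ (-a) ≤ 2 ^ a * N ^ (-a) := by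
    intro x hx hNx
    have h2 : x ^ (-a) ≤ (N / 2) ^ (-a) :=
      Real.rpow_le_rpow_of_nonpos (by positivity) (by linarith) (by linarith)
    rwa [Real.div_rpow hN.le zero_le_two, Real.rpow_neg zero_le_two a, div_inv_eq_mul,
      mul_comm] at h2
  rcases le_total B A with hBA | hAB
  · calc A ^ (-a) * B ^ (-b) ≤ 2 ^ a * N ^ (-a) * B ^ (-b) := by
          gcongr
          exact key A hA (by linarith)
      _ ≤ _ := by
          gcongr
          exact le_add_of_nonneg_right (by positivity)
  · have hsplit : ∀ x : ℝ, 0 < x → x ^ (-b) = x ^ (-a) * x ^ (-(b - a)) := fun x hx => by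
      rw [← Real.rpow_add hx]; congr 1; ring
    calc A ^ (-a) * B ^ (-b) = B ^ (-a) * (A ^ (-a) * B ^ (-(b - a))) := by
          rw [hsplit B hB]; ring
      _ ≤ (2 ^ a * N ^ (-a)) * (A ^ (-a) * A ^ (-(b - a))) := by
          gcongr ?_ * (_ * ?_)
          · exact key B hB (by linarith)
          · exact Real.rpow_le_rpow_of_nonpos hA hAB (by linarith)
      _ = 2 ^ a * N ^ (-a) * A ^ (-b) := by rw [← hsplit A hA]
      _ ≤ _ := by
          gcongr
          exact le_add_of_nonneg_left (by positivity)

theorem stmt1 (d : ℕ) (hd : 1 ≤ d) (ε a b : ℝ) (hε0 : 0 < ε) (hεd : ε < d)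
    (ha : 0 < a) (hab : a ≤ b) (hbe : (d : ℝ) < b + ε) (hbd : b ≠ (d : ℝ)) :
    ∃ C : ℝ, 0 < C ∧ ∀ n n' : Fin d → ℤ,
      (Summable fun n₁ : Fin d → ℤ =>
        1 / (znorm (n - n₁) ^ a * znorm n₁ ^ ε * znorm (n₁ - n') ^ b)) ∧
      ∑' n₁ : Fin d → ℤ, 1 / (znorm (n - n₁) ^ a * znorm n₁ ^ ε * znorm (n₁ - n') ^ b)
        ≤ C / (znorm (n - n') ^ a *
            (min (znorm n) (znorm n')) ^ min ε (min a (ε + b - d))) := by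
  obtain ⟨C, hC, hK⟩ := exists_sum_rpow_mul_rpow_le d hε0 hεd (ha.trans_le hab) hbe hbd
  refine ⟨2 ^ a * (C + C), by positivity, fun n n' => ?_⟩
  have hnonneg : ∀ m : Fin d → ℤ,
      0 ≤ 1 / (znorm (n - m) ^ a * znorm m ^ ε * znorm (m - n') ^ b) := fun m => by
    have := znorm_pos (n - m)
    have := znorm_pos m
    have := znorm_pos (m - n')
    positivity
  have hμ : 0 < min (znorm n) (znorm n') := lt_min (znorm_pos n) (znorm_pos n')
  have hμ1 : 1 ≤ min (znorm n) (znorm n') := le_min (one_le_znorm n) (one_le_znorm n')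
  have hN := znorm_pos (n - n')
  have hpt : ∀ m : Fin d → ℤ,
      1 / (znorm (n - m) ^ a * znorm m ^ ε * znorm (m - n') ^ b) ≤
        2 ^ a * znorm (n - n') ^ (-a) * (znorm m ^ (-ε) * znorm (m - n') ^ (-b) +
          znorm m ^ (-ε) * znorm (m - n) ^ (-b)) := by
    intro m
    have hA := znorm_pos (m - n)
    have hE := znorm_pos m
    have hB := znorm_pos (m - n')
    rw [znorm_sub_comm n m]
    have h := mul_le_mul_of_nonneg_left
      (rpow_neg_mul_rpow_neg_le hN hA hB ha hab (znorm_sub_le n m n'))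
      (Real.rpow_nonneg hE.le (-ε))
    calc 1 / (znorm (m - n) ^ a * znorm m ^ ε * znorm (m - n') ^ b)
        = znorm m ^ (-ε) * (znorm (m - n) ^ (-a) * znorm (m - n') ^ (-b)) := by
          rw [Real.rpow_neg hE.le, Real.rpow_neg hA.le, Real.rpow_neg hB.le, one_div,
            mul_inv, mul_inv]
          ring
      _ ≤ _ := h
      _ = _ := by ring
  have hmono : ∀ k : Fin d → ℤ, min (znorm n) (znorm n') ≤ znorm k →
      znorm k ^ (-min ε (ε + b - d)) ≤
        min (znorm n) (znorm n') ^ (-min ε (min a (ε + b - d))) := by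
    intro k hk
    have hpos : 0 < min ε (ε + b - d) := lt_min hε0 (by linarith)
    refine (Real.rpow_le_rpow_of_nonpos hμ hk (by linarith)).trans
      (Real.rpow_le_rpow_of_exponent_le hμ1 (neg_le_neg ?_))
    exact min_le_min_left _ (min_le_right _ _)
  have hbound : ∀ s : Finset (Fin d → ℤ),
      ∑ m ∈ s, 1 / (znorm (n - m) ^ a * znorm m ^ ε * znorm (m - n') ^ b) ≤
        2 ^ a * (C + C) / (znorm (n - n') ^ a *
          (min (znorm n) (znorm n')) ^ min ε (min a (ε + b - d))) := by
    intro s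
    refine (Finset.sum_le_sum fun m _ => hpt m).trans ?_
    rw [← Finset.mul_sum, Finset.sum_add_distrib]
    have h₁ := (hK n' s).trans (mul_le_mul_of_nonneg_left (hmono n' (min_le_right _ _)) hC.le)
    have h₂ := (hK n s).trans (mul_le_mul_of_nonneg_left (hmono n (min_le_left _ _)) hC.le)
    refine (mul_le_mul_of_nonneg_left (add_le_add h₁ h₂) (by positivity)).trans_eq ?_
    rw [Real.rpow_neg hN.le, Real.rpow_neg hμ.le, div_eq_mul_inv, mul_inv]
    ring
  exact ⟨summable_of_sum_le hnonneg hbound, Real.tsum_le_of_sum_le hnonneg hbound⟩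
end

section
/- Let m, s ∈ ℕ and let f(Y₁,…,Y_m) be a real-valued polynomial of degree at most s in i.i.d. Bernoulli ±1 random variables Y₁,…,Y_m. Then for every p ≥ 1 there is a constant C(p,s) depending only on p and s such that (E|f|^p)^{1/p} ≤ C(p,s) · (E f²)^{1/2}. -/
/-- Expectation of a function of `m` i.i.d. Bernoulli ±1 random variables,
realized as the average over the uniform measure on `{±1}^m`. -/
noncomputable def bernExp (m : ℕ) (g : (Fin m → ℝ) → ℝ) : ℝ :=
  (∑ y : Fin m → Bool, g (fun i => if y i then 1 else -1)) / 2 ^ m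

/-- The mean of a function on the cube `{±1}^m`, whose points are encoded by Booleans. -/
noncomputable def cubeMean (m : ℕ) (f : (Fin m → Bool) → ℝ) : ℝ :=
  (∑ y, f y) / 2 ^ m

/-- The sign `±1` encoded by a Boolean. -/
noncomputable def boolSign (b : Bool) : ℝ := if b then 1 else -1

/-- The Walsh function `∏ i ∈ S, Y i` on the cube. -/
noncomputable def walsh {m : ℕ} (S : Finset (Fin m)) (y : Fin m → Bool) : ℝ :=
  ∏ i ∈ S, boolSign (y i)

/-- The polynomials of degree less than `s` on the cube. -/
noncomputable def degreeLT (m s : ℕ) : Submodule ℝ ((Fin m → Bool) → ℝ) :=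
  Submodule.span ℝ {f | ∃ S : Finset (Fin m), S.card < s ∧ f = walsh S}

lemma boolSign_mul_self (b : Bool) : boolSign b * boolSign b = 1 := by
  cases b <;> simp [boolSign]

lemma walsh_mul_walsh {m : ℕ} (S T : Finset (Fin m)) :
    walsh S * walsh T = walsh (symmDiff S T) := by
  funext y
  simp only [Pi.mul_apply, walsh]
  rw [← Fintype.prod_ite_mem S, ← Fintype.prod_ite_mem T, ← Fintype.prod_ite_mem (symmDiff S T),
    ← Finset.prod_mul_distrib]
  refine Finset.prod_congr rfl fun i _ => ?_
  by_cases hS : i ∈ S <;> by_cases hT : i ∈ T <;>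
    simp [Finset.mem_symmDiff, hS, hT, boolSign_mul_self]

lemma walsh_mem_degreeLT {m s : ℕ} {S : Finset (Fin m)} (h : S.card < s) :
    walsh S ∈ degreeLT m s :=
  Submodule.subset_span ⟨S, h, rfl⟩

lemma degreeLT_zero (m : ℕ) : degreeLT m 0 = ⊥ := by
  simp [degreeLT]

lemma mul_mem_degreeLT {m s t : ℕ} {f g : (Fin m → Bool) → ℝ}
    (hf : f ∈ degreeLT m s) (hg : g ∈ degreeLT m t) : f * g ∈ degreeLT m (s + t) := by
  have h := Submodule.mul_mem_mul hf hg
  rw [degreeLT, degreeLT, Submodule.span_mul_span] at h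
  refine Submodule.span_le.2 ?_ h
  rintro _ ⟨_, ⟨S, hS, rfl⟩, _, ⟨T, hT, rfl⟩, rfl⟩
  change walsh S * walsh T ∈ degreeLT m (s + t)
  rw [walsh_mul_walsh]
  apply walsh_mem_degreeLT
  have h1 : (symmDiff S T).card ≤ (S ∪ T).card := Finset.card_le_card symmDiff_le_sup
  have h2 := Finset.card_union_le S T
  omega

lemma walsh_cons {m : ℕ} (S : Finset (Fin (m + 1))) (b : Bool) (y : Fin m → Bool) :
    walsh S (Fin.cons b y) =
      (if 0 ∈ S then boolSign b else 1) * walsh (Finset.univ.filter fun i => i.succ ∈ S) y := by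
  simp only [walsh]
  rw [← Fintype.prod_ite_mem S, Fin.prod_univ_succ, Finset.prod_filter]
  simp

lemma card_eq_ite_add_card_filter_succ {m : ℕ} (S : Finset (Fin (m + 1))) :
    S.card = (if 0 ∈ S then 1 else 0) + (Finset.univ.filter fun i : Fin m => i.succ ∈ S).card := by
  have h := Fin.card_filter_univ_succ (fun i => i ∈ S)
  rw [Finset.filter_univ_mem] at h
  rw [h]
  split_ifs <;> simp [add_comm]

lemma exists_cons_decomposition {m s : ℕ} {f : (Fin (m + 1) → Bool) → ℝ}
    (hf : f ∈ degreeLT (m + 1) (s + 1)) :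
    ∃ g ∈ degreeLT m (s + 1), ∃ h ∈ degreeLT m s,
      ∀ b y, f (Fin.cons b y) = g y + boolSign b * h y := by
  induction hf using Submodule.span_induction with
  | mem f hf =>
    obtain ⟨S, hS, rfl⟩ := hf
    have hc := card_eq_ite_add_card_filter_succ S
    by_cases h0 : 0 ∈ S
    · rw [if_pos h0] at hc
      exact ⟨0, zero_mem _, walsh (Finset.univ.filter fun i => i.succ ∈ S),
        walsh_mem_degreeLT (by omega), fun b y => by rw [walsh_cons, if_pos h0]; simp⟩
    · rw [if_neg h0] at hc
      exact ⟨walsh (Finset.univ.filter fun i => i.succ ∈ S), walsh_mem_degreeLT (by omega), 0, zero_mem _,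
        fun b y => by rw [walsh_cons, if_neg h0]; simp⟩
  | zero => exact ⟨0, zero_mem _, 0, zero_mem _, by simp⟩
  | add f₁ f₂ _ _ h₁ h₂ =>
    obtain ⟨g₁, hg₁, k₁, hk₁, e₁⟩ := h₁
    obtain ⟨g₂, hg₂, k₂, hk₂, e₂⟩ := h₂
    refine ⟨_, add_mem hg₁ hg₂, _, add_mem hk₁ hk₂, fun b y => ?_⟩
    simp only [Pi.add_apply, e₁, e₂]
    ring
  | smul a f _ h =>
    obtain ⟨g, hg, k, hk, e⟩ := h
    refine ⟨_, Submodule.smul_mem _ a hg, _, Submodule.smul_mem _ a hk, fun b y => ?_⟩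
    simp only [Pi.smul_apply, smul_eq_mul, e]
    ring

lemma cubeMean_add (m : ℕ) (f g : (Fin m → Bool) → ℝ) :
    cubeMean m (fun y => f y + g y) = cubeMean m f + cubeMean m g := by
  simp only [cubeMean, Finset.sum_add_distrib, add_div]

lemma cubeMean_const_mul (m : ℕ) (a : ℝ) (f : (Fin m → Bool) → ℝ) :
    cubeMean m (fun y => a * f y) = a * cubeMean m f := by
  simp only [cubeMean, ← Finset.mul_sum, mul_div_assoc]

lemma cubeMean_nonneg {m : ℕ} {f : (Fin m → Bool) → ℝ} (hf : ∀ y, 0 ≤ f y) :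
    0 ≤ cubeMean m f :=
  div_nonneg (Finset.sum_nonneg fun y _ => hf y) (by positivity)

lemma cubeMean_succ (m : ℕ) (f : (Fin (m + 1) → Bool) → ℝ) :
    cubeMean (m + 1) f =
      cubeMean m fun y => (f (Fin.cons true y) + f (Fin.cons false y)) / 2 := by
  have h : ∑ y, f y = ∑ x : Bool × (Fin m → Bool), f (Fin.cons x.1 x.2) :=
    (Fintype.sum_equiv (Fin.consEquiv fun _ => Bool) _ _ fun _ => rfl).symm
  simp only [cubeMean]
  rw [h, Fintype.sum_prod_type, Fintype.sum_bool, ← Finset.sum_add_distrib, ← Finset.sum_div,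
    pow_succ, div_div, mul_comm (2 : ℝ)]

lemma cubeMean_mul_sq_le (m : ℕ) (f g : (Fin m → Bool) → ℝ) :
    (cubeMean m fun y => f y * g y) ^ 2 ≤
      (cubeMean m fun y => f y ^ 2) * cubeMean m fun y => g y ^ 2 := by
  simp only [cubeMean]
  rw [div_pow, div_mul_div_comm, ← sq]
  gcongr
  exact Finset.sum_mul_sq_le_sq_mul_sq _ _ _

/-- Bonami's lemma. -/
lemma cubeMean_pow_four_le (m : ℕ) : ∀ (s : ℕ) (f : (Fin m → Bool) → ℝ), f ∈ degreeLT m s →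
    (cubeMean m fun y => f y ^ 4) ≤ 9 ^ s * (cubeMean m fun y => f y ^ 2) ^ 2 := by
  induction m with
  | zero =>
    intro s f _
    have h : (1 : ℝ) ≤ 9 ^ s := one_le_pow₀ (by norm_num)
    simp only [cubeMean, Finset.univ_unique, Finset.sum_singleton, pow_zero, div_one]
    nlinarith [mul_le_mul_of_nonneg_right h (by positivity : 0 ≤ f default ^ 4)]
  | succ m ih =>
    intro s f hf
    rcases s with - | s
    · rw [degreeLT_zero, Submodule.mem_bot] at hf
      simp [hf, cubeMean]
    obtain ⟨g, hg, h, hh, e⟩ := exists_cons_decomposition hf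
    have hg4 := ih _ g hg
    have hh4 := ih _ h hh
    have e2 : (cubeMean (m + 1) fun y => f y ^ 2) =
        (cubeMean m fun y => g y ^ 2) + cubeMean m fun y => h y ^ 2 := by
      rw [cubeMean_succ, ← cubeMean_add]
      congr 1; funext y
      simp only [e, boolSign, if_true, Bool.false_eq_true, if_false]
      ring
    have e4 : (cubeMean (m + 1) fun y => f y ^ 4) =
        (cubeMean m fun y => g y ^ 4) + (6 * (cubeMean m fun y => g y ^ 2 * h y ^ 2)
          + cubeMean m fun y => h y ^ 4) := by
      rw [cubeMean_succ, ← cubeMean_const_mul, ← cubeMean_add, ← cubeMean_add]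
      congr 1; funext y
      simp only [e, boolSign, if_true, Bool.false_eq_true, if_false]
      ring
    have hcs := cubeMean_mul_sq_le m (fun y => g y ^ 2) (fun y => h y ^ 2)
    simp only [← pow_mul, Nat.reduceMul] at hcs
    have hA : 0 ≤ cubeMean m fun y => g y ^ 2 := cubeMean_nonneg fun y => sq_nonneg _
    have hB : 0 ≤ cubeMean m fun y => h y ^ 2 := cubeMean_nonneg fun y => sq_nonneg _
    have hB4 : 0 ≤ cubeMean m fun y => h y ^ 4 := cubeMean_nonneg fun y => by positivity
    rw [e2, e4]
    generalize (cubeMean m fun y => g y ^ 2) = A at *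
    generalize (cubeMean m fun y => h y ^ 2) = B at *
    generalize (cubeMean m fun y => g y ^ 4) = A₄ at *
    generalize (cubeMean m fun y => h y ^ 4) = B₄ at *
    generalize (cubeMean m fun y => g y ^ 2 * h y ^ 2) = M at *
    have hP : (0 : ℝ) < 9 ^ s := by positivity
    rw [pow_succ (9 : ℝ) s] at hg4 ⊢
    generalize (9 : ℝ) ^ s = P at *
    have hM : M ≤ 3 * P * (A * B) := by
      refine le_of_sq_le_sq ?_ (by positivity)
      calc M ^ 2 ≤ A₄ * B₄ := hcs
        _ ≤ (P * 9 * A ^ 2) * (P * B ^ 2) := by gcongr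
        _ = (3 * P * (A * B)) ^ 2 := by ring
    nlinarith [mul_nonneg hP.le (sq_nonneg B)]

lemma exists_cubeMean_two_pow_le (k : ℕ) : ∀ s : ℕ, ∃ K : ℝ, 0 < K ∧
    ∀ (m : ℕ) (f : (Fin m → Bool) → ℝ), f ∈ degreeLT m s →
      (cubeMean m fun y => f y ^ 2 ^ (k + 1)) ≤ K * (cubeMean m fun y => f y ^ 2) ^ 2 ^ k := by
  induction k with
  | zero => exact fun s => ⟨1, one_pos, fun m f _ => by simp⟩
  | succ k ih =>
    intro s
    obtain ⟨K, hK, h⟩ := ih (s + s)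
    refine ⟨K * (9 ^ s) ^ 2 ^ k, by positivity, fun m f hf => ?_⟩
    have h1 := h m (f * f) (mul_mem_degreeLT hf hf)
    simp only [Pi.mul_apply, ← sq, ← pow_mul, ← pow_succ'] at h1
    refine h1.trans ?_
    rw [mul_assoc, pow_succ' 2 k, pow_mul _ 2, ← mul_pow]
    have h4 : 0 ≤ cubeMean m fun y => f y ^ 4 := cubeMean_nonneg fun y => by positivity
    gcongr
    exact cubeMean_pow_four_le m s f hf

/-- Monotonicity of the `L^p` norms on the cube. -/
lemma cubeMean_rpow_le {m : ℕ} {f : (Fin m → Bool) → ℝ} (hf : ∀ y, 0 ≤ f y) {p q : ℝ}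
    (hp : 0 < p) (hpq : p ≤ q) :
    (cubeMean m fun y => f y ^ p) ^ (1 / p) ≤ (cubeMean m fun y => f y ^ q) ^ (1 / q) := by
  have h := Real.arith_mean_le_rpow_mean Finset.univ (fun _ : Fin m → Bool => ((2 : ℝ) ^ m)⁻¹)
    (fun y => f y ^ p) (fun _ _ => by positivity) (by simp)
    (fun y _ => Real.rpow_nonneg (hf y) p) ((one_le_div hp).2 hpq)
  have e : ∀ y, (f y ^ p) ^ (q / p) = f y ^ q := fun y => by
    rw [← Real.rpow_mul (hf y), mul_div_cancel₀ _ hp.ne']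
  simp only [e, inv_mul_eq_div, ← Finset.sum_div] at h
  have hq0 : 0 ≤ cubeMean m fun y => f y ^ q := cubeMean_nonneg fun y => Real.rpow_nonneg (hf y) q
  have hp0 : 0 ≤ cubeMean m fun y => f y ^ p := cubeMean_nonneg fun y => Real.rpow_nonneg (hf y) p
  calc (cubeMean m fun y => f y ^ p) ^ (1 / p)
      ≤ ((cubeMean m fun y => f y ^ q) ^ (1 / (q / p))) ^ (1 / p) :=
        Real.rpow_le_rpow hp0 h (by positivity)
    _ = _ := by
        rw [← Real.rpow_mul hq0]
        congr 1
        have := hp.trans_le hpq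
        field_simp

theorem stmt3 (s : ℕ) (p : ℝ) (hp : 1 ≤ p) :
    ∃ C : ℝ, 0 < C ∧ ∀ (m : ℕ) (c : Finset (Fin m) → ℝ),
      (∀ S : Finset (Fin m), s < S.card → c S = 0) →
      (bernExp m (fun Y => |∑ S : Finset (Fin m), c S * ∏ i ∈ S, Y i| ^ p)) ^ (1 / p)
        ≤ C * (bernExp m (fun Y => (∑ S : Finset (Fin m), c S * ∏ i ∈ S, Y i) ^ 2))
            ^ (1 / 2 : ℝ) := by
  obtain ⟨k, hk⟩ := pow_unbounded_of_one_lt p (one_lt_two (α := ℝ))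
  obtain ⟨K, hK, hbound⟩ := exists_cubeMean_two_pow_le k (s + 1)
  refine ⟨K ^ (1 / (2 ^ (k + 1) : ℝ)), by positivity, fun m c hc => ?_⟩
  let f : (Fin m → Bool) → ℝ := fun y => ∑ S, c S * walsh S y
  change (cubeMean m fun y => |f y| ^ p) ^ (1 / p) ≤
    _ * (cubeMean m fun y => f y ^ 2) ^ (1 / 2 : ℝ)
  have hf : f ∈ degreeLT m (s + 1) := by
    have : f = ∑ S, c S • walsh S := by
      funext y
      simp [f, Finset.sum_apply]
    rw [this]
    refine sum_mem fun S _ => ?_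
    by_cases hS : s < S.card
    · simp [hc S hS]
    · exact Submodule.smul_mem _ _ (walsh_mem_degreeLT (by omega))
  have hpq : p ≤ (2 : ℝ) ^ (k + 1) := by
    rw [pow_succ]
    linarith
  have hM : 0 ≤ cubeMean m fun y => f y ^ 2 := cubeMean_nonneg fun y => sq_nonneg _
  have heven : Even (2 ^ (k + 1)) := by simp [pow_succ]
  have e : (fun y => |f y| ^ ((2 : ℝ) ^ (k + 1))) = fun y => f y ^ 2 ^ (k + 1) := by
    funext y
    rw [← heven.pow_abs (f y), ← Real.rpow_natCast |f y| (2 ^ (k + 1)), Nat.cast_pow,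
      Nat.cast_ofNat]
  calc _ ≤ (cubeMean m fun y => |f y| ^ ((2 : ℝ) ^ (k + 1))) ^ (1 / (2 ^ (k + 1) : ℝ)) :=
        cubeMean_rpow_le (fun y => abs_nonneg _) (by linarith) hpq
    _ ≤ (K * (cubeMean m fun y => f y ^ 2) ^ 2 ^ k) ^ (1 / (2 ^ (k + 1) : ℝ)) := by
        rw [e]
        exact Real.rpow_le_rpow (cubeMean_nonneg fun y => heven.pow_nonneg _) (hbound m f hf)
          (by positivity)
    _ = _ := by
        rw [Real.mul_rpow hK.le (by positivity), ← Real.rpow_natCast _ (2 ^ k),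
          ← Real.rpow_mul hM]
        congr 2
        push_cast
        rw [pow_succ]
        field_simp
end

section
/- Let d ≥ 5, 1/4 < α ≤ 1/3, v_n = κ|n|^{-α}, and suppose G̃₀ satisfies |G̃₀(n,n')| ≤ C_d/|n-n'|^{d-2}. Define P₆''(n₁,n₃) = G̃₀(n₁,n₃) · Σ_{n₂∈ℤ^d} (v_{n₂}⁶ - v_{n₁}⁶) · G̃₀(n₁,n₂)² · G̃₀(n₂,n₃)². Then |P₆''(n₁,n₃)| ≤ C(d,α)·κ⁶ / (|n₁-n₃|^{3(d-2)-1} · (min{|n₁|,|n₃|})^{1+6α}) for all n₁, n₃ ∈ ℤ^d. -/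
lemma znorm_eq_max_norm {d : ℕ} (n : Fin d → ℤ) :
    znorm n = max ‖fun i => (n i : ℝ)‖ 1 := by
  have h : ((Finset.univ.sup fun i => (n i).natAbs : ℕ) : ℝ) = ‖fun i => (n i : ℝ)‖ := by
    apply le_antisymm
    · rcases (Finset.univ : Finset (Fin d)).eq_empty_or_nonempty with he | hne
      · simp [he]
      · obtain ⟨i, -, hi⟩ := Finset.exists_mem_eq_sup _ hne fun i => (n i).natAbs
        rw [hi, Nat.cast_natAbs, Int.cast_abs, ← Real.norm_eq_abs]
        exact norm_le_pi_norm (fun i => (n i : ℝ)) i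
    · refine (pi_norm_le_iff_of_nonneg (by positivity)).2 fun i => ?_
      rw [Real.norm_eq_abs, ← Int.cast_abs, ← Nat.cast_natAbs]
      exact_mod_cast Finset.le_sup (f := fun i => (n i).natAbs) (Finset.mem_univ i)
  rw [znorm, h]

lemma summable_inv_znorm_pow {d p : ℕ} (hp : d < p) :
    Summable fun n : Fin d → ℤ => (znorm n ^ p)⁻¹ := by
  classical
  let b := Pi.basisFun ℝ (Fin d)
  let L := Submodule.span ℤ (Set.range b)
  have hrank : Module.finrank ℤ L = d := by
    rw [ZLattice.rank ℝ L]; simp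
  have hmem (n : Fin d → ℤ) : (fun i => (n i : ℝ)) ∈ L := by
    refine (Module.Basis.mem_span_iff_repr_mem ℤ b _).2 fun i => ?_
    simp [b]
  let f (n : Fin d → ℤ) : L := ⟨fun i => (n i : ℝ), hmem n⟩
  have hf : Function.Injective f := fun m n h => by
    ext i
    have h' : (m i : ℝ) = n i := congrFun (congrArg Subtype.val h) i
    exact_mod_cast h'
  have hs := (ZLattice.summable_norm_pow_inv L p (by rwa [hrank])).comp_injective hf
  refine Summable.of_norm_bounded_eventually hs ?_
  filter_upwards [(Set.finite_singleton (0 : Fin d → ℤ)).compl_mem_cofinite] with n hn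
  have hpos : 0 < ‖fun i => (n i : ℝ)‖ := norm_pos_iff.2 fun h => hn <| by
    ext i
    have h' : (n i : ℝ) = 0 := congrFun h i
    exact_mod_cast h'
  rw [Real.norm_of_nonneg (inv_nonneg.2 (pow_nonneg (zero_le_one.trans (one_le_znorm n)) _))]
  change _ ≤ ‖fun i => (n i : ℝ)‖⁻¹ ^ p
  rw [inv_pow, znorm_eq_max_norm]
  gcongr
  exact le_max_left _ _

/-- Difference regularization of the power weight. -/
lemma abs_rpow_neg_sub_rpow_neg_le {β s t : ℝ} (hβ0 : 0 ≤ β) (hβ : β ≤ 2) (hs : 0 < s)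
    {x y : ℝ} (hx : s ≤ x) (hy : s ≤ y) (ht : |x - y| ≤ t) :
    |x ^ (-β) - y ^ (-β)| ≤ 2 * t * s ^ (-(1 + β)) := by
  wlog hxy : x ≤ y generalizing x y
  · rw [abs_sub_comm] at ht ⊢
    exact this hy hx ht (le_of_not_ge hxy)
  have hx0 : 0 < x := hs.trans_le hx
  have hy0 : 0 < y := hs.trans_le hy
  have hratio : y ^ (-β) = x ^ (-β) * (x / y) ^ β := by
    rw [Real.div_rpow hx0.le hy0.le, Real.rpow_neg hx0.le, Real.rpow_neg hy0.le]
    have := (Real.rpow_pos_of_pos hx0 β).ne'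
    field_simp
  have hle : x / y ≤ 1 := (div_le_one hy0).2 hxy
  have hpos : 0 < x / y := by positivity
  have hsq : (x / y) ^ 2 ≤ (x / y) ^ β := by
    rw [← Real.rpow_natCast]
    exact Real.rpow_le_rpow_of_exponent_ge hpos hle (by exact_mod_cast hβ)
  have hone : (x / y) ^ β ≤ 1 := Real.rpow_le_one hpos.le hle hβ0
  have hyx : y - x ≤ t := by rw [abs_sub_comm] at ht; exact (le_abs_self _).trans ht
  have hdiv : 1 - x / y ≤ t / x := by
    rw [one_sub_div hy0.ne']
    gcongr
    linarith
  rw [hratio, ← mul_one_sub, abs_of_nonneg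
    (mul_nonneg (Real.rpow_nonneg hx0.le _) (sub_nonneg.2 hone))]
  have ht0 : 0 ≤ t := (abs_nonneg _).trans ht
  calc x ^ (-β) * (1 - (x / y) ^ β) ≤ x ^ (-β) * (2 * (t / x)) := by
        gcongr
        nlinarith [sq_nonneg (1 - x / y)]
    _ = 2 * t * x ^ (-(1 + β)) := by
        rw [show -(1 + β) = -β - 1 by ring, Real.rpow_sub_one hx0.ne']
        ring
    _ ≤ 2 * t * s ^ (-(1 + β)) := by
        have := Real.rpow_le_rpow_of_nonpos hs hx (by linarith : -(1 + β) ≤ 0)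
        gcongr

/-- A product of two decaying kernels, one weakened by a power, is controlled by their sum. -/
lemma mul_inv_pow_mul_inv_pow_le {a b r : ℝ} (ha : 1 ≤ a) (hb : 1 ≤ b) (hr : 1 ≤ r)
    (hrab : r ≤ a + b) (q : ℕ) :
    a * (a ^ (q + 1))⁻¹ * (b ^ (q + 1))⁻¹ ≤
      2 ^ (q + 1) * (r ^ q)⁻¹ * ((a ^ (q + 1))⁻¹ + (b ^ (q + 1))⁻¹) := by
  have ha0 : 0 < a := by linarith
  have hb0 : 0 < b := by linarith
  have hr0 : 0 < r := by linarith
  have key {c : ℝ} (hc : r / 2 ≤ c) (k : ℕ) : (c ^ k)⁻¹ ≤ 2 ^ k * (r ^ k)⁻¹ := by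
    calc (c ^ k)⁻¹ ≤ ((r / 2) ^ k)⁻¹ := by gcongr
      _ = 2 ^ k * (r ^ k)⁻¹ := by rw [div_pow, inv_div, div_eq_mul_inv]
  by_cases h : r / 2 ≤ a
  · calc a * (a ^ (q + 1))⁻¹ * (b ^ (q + 1))⁻¹ = (a ^ q)⁻¹ * (b ^ (q + 1))⁻¹ := by
          rw [pow_succ a]
          field_simp
      _ ≤ (2 ^ q * (r ^ q)⁻¹) * (b ^ (q + 1))⁻¹ := by gcongr; exact key h q
      _ ≤ (2 ^ (q + 1) * (r ^ q)⁻¹) * ((a ^ (q + 1))⁻¹ + (b ^ (q + 1))⁻¹) := by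
          gcongr
          · norm_num
          · omega
          · exact le_add_of_nonneg_left (by positivity)
  · have hbr : r / 2 ≤ b := by linarith
    calc a * (a ^ (q + 1))⁻¹ * (b ^ (q + 1))⁻¹
        ≤ r * (a ^ (q + 1))⁻¹ * (2 ^ (q + 1) * (r ^ (q + 1))⁻¹) := by
          gcongr
          · linarith
          · exact key hbr _
      _ = (2 ^ (q + 1) * (r ^ q)⁻¹) * (a ^ (q + 1))⁻¹ := by
          rw [pow_succ r]
          field_simp
      _ ≤ (2 ^ (q + 1) * (r ^ q)⁻¹) * ((a ^ (q + 1))⁻¹ + (b ^ (q + 1))⁻¹) := by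
          gcongr
          exact le_add_of_nonneg_right (by positivity)

/-- Kernels based at two points `y`, `z` and evaluated near the origin. -/
lemma rpow_neg_mul_inv_pow_mul_inv_pow_le {β x y z a b r : ℝ} {q : ℕ} (hβ : β ≤ q + 1)
    (hx : 1 ≤ x) (hy : 1 ≤ y) (hz : 1 ≤ z) (hr : 1 ≤ r) (hxm : x ≤ min y z)
    (hya : y / 2 ≤ a) (hzb : z / 2 ≤ b) (hryz : r ≤ y + z) :
    x ^ (-β) * (a ^ (q + 1))⁻¹ * (b ^ (q + 1))⁻¹ ≤
      8 ^ (q + 1) * (r ^ q)⁻¹ * min y z ^ (-(1 + β)) * (x ^ (q + 1))⁻¹ := by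
  set m := min y z
  have hx0 : 0 < x := by linarith
  have hy0 : 0 < y := by linarith
  have hz0 : 0 < z := by linarith
  have hr0 : 0 < r := by linarith
  have hm0 : 0 < m := hx0.trans_le hxm
  have hx_pow : x ^ (-β) ≤ m ^ ((q + 1 : ℕ) - β) * (x ^ (q + 1))⁻¹ := by
    calc x ^ (-β) = x ^ (((q + 1 : ℕ) : ℝ) - β) * (x ^ (q + 1))⁻¹ := by
          rw [← Real.rpow_natCast x, ← Real.rpow_neg hx0.le, ← Real.rpow_add hx0]
          ring_nf
      _ ≤ m ^ ((q + 1 : ℕ) - β) * (x ^ (q + 1))⁻¹ := by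
          gcongr
          push_cast
          linarith
  have hprod : (r / 2) ^ q * m ^ (q + 2) ≤ y ^ (q + 1) * z ^ (q + 1) := by
    have hmM : m * max y z = y * z := min_mul_max y z
    have hrM : r / 2 ≤ max y z := by
      linarith [le_max_left y z, le_max_right y z]
    calc (r / 2) ^ q * m ^ (q + 2) ≤ max y z ^ q * (m ^ (q + 1) * max y z) := by
          rw [pow_succ m (q + 1)]
          gcongr
          exact (min_le_left y z).trans (le_max_left y z)
      _ = (m * max y z) ^ (q + 1) := by ring
      _ = y ^ (q + 1) * z ^ (q + 1) := by rw [hmM, mul_pow]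
  have ha0 : 0 < a := by linarith
  have hb0 : 0 < b := by linarith
  have hab : (a ^ (q + 1))⁻¹ * (b ^ (q + 1))⁻¹ ≤ 8 ^ (q + 1) * (r ^ q)⁻¹ * (m ^ (q + 2))⁻¹ := by
    calc (a ^ (q + 1))⁻¹ * (b ^ (q + 1))⁻¹
        ≤ ((y / 2) ^ (q + 1))⁻¹ * ((z / 2) ^ (q + 1))⁻¹ := by gcongr
      _ = 4 ^ (q + 1) * (y ^ (q + 1) * z ^ (q + 1))⁻¹ := by
          rw [show (4 : ℝ) = 2 * 2 by norm_num, mul_pow, div_pow, div_pow]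
          field_simp
      _ ≤ 4 ^ (q + 1) * ((r / 2) ^ q * m ^ (q + 2))⁻¹ := by gcongr
      _ = 4 ^ (q + 1) * 2 ^ q * (r ^ q)⁻¹ * (m ^ (q + 2))⁻¹ := by
          rw [div_pow]
          field_simp
      _ ≤ 8 ^ (q + 1) * (r ^ q)⁻¹ * (m ^ (q + 2))⁻¹ := by
          gcongr
          rw [show (8 : ℝ) = 4 * 2 by norm_num, mul_pow]
          gcongr
          · norm_num
          · omega
  calc x ^ (-β) * (a ^ (q + 1))⁻¹ * (b ^ (q + 1))⁻¹
      = x ^ (-β) * ((a ^ (q + 1))⁻¹ * (b ^ (q + 1))⁻¹) := by ring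
    _ ≤ (m ^ ((q + 1 : ℕ) - β) * (x ^ (q + 1))⁻¹) *
          (8 ^ (q + 1) * (r ^ q)⁻¹ * (m ^ (q + 2))⁻¹) := by
        gcongr
    _ = 8 ^ (q + 1) * (r ^ q)⁻¹ * (m ^ (((q + 1 : ℕ) : ℝ) - β) * (m ^ (q + 2))⁻¹) *
          (x ^ (q + 1))⁻¹ := by ring
    _ = 8 ^ (q + 1) * (r ^ q)⁻¹ * m ^ (-(1 + β)) * (x ^ (q + 1))⁻¹ := by
        rw [← Real.rpow_natCast m (q + 2), ← Real.rpow_neg hm0.le, ← Real.rpow_add hm0]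
        congr 3
        push_cast
        ring

lemma abs_sub_mul_inv_pow_mul_inv_pow_le {β x y z a b r : ℝ} {q : ℕ} (hβ0 : 0 ≤ β)
    (hβ : β ≤ 2) (hq : 1 ≤ q) (hx : 1 ≤ x) (hy : 1 ≤ y) (hz : 1 ≤ z) (ha : 1 ≤ a)
    (hb : 1 ≤ b) (hr : 1 ≤ r) (hrab : r ≤ a + b) (hryz : r ≤ y + z)
    (hxy : x ≤ y + a) (hyx : y ≤ x + a) (hzx : z ≤ x + b) :
    |x ^ (-β) - y ^ (-β)| * (a ^ (q + 1))⁻¹ * (b ^ (q + 1))⁻¹ ≤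
      16 * 8 ^ (q + 1) * (r ^ q)⁻¹ * min y z ^ (-(1 + β)) *
        ((a ^ (q + 1))⁻¹ + (b ^ (q + 1))⁻¹ + (x ^ (q + 1))⁻¹) := by
  set m := min y z
  have hm1 : 1 ≤ m := le_min hy hz
  have hm0 : 0 < m := by linarith
  have hx0 : 0 < x := by linarith
  have hy0 : 0 < y := by linarith
  have ha0 : 0 < a := by linarith
  have hb0 : 0 < b := by linarith
  have hr0 : 0 < r := by linarith
  have hmy : m ≤ y := min_le_left y z
  have hmz : m ≤ z := min_le_right y z
  have hmβ : 0 < m ^ (-(1 + β)) := Real.rpow_pos_of_pos hm0 _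
  rcases le_or_gt (m / 2) x with h | h
  · have hD := abs_rpow_neg_sub_rpow_neg_le hβ0 hβ (half_pos hm0) h
      (show m / 2 ≤ y by linarith) (abs_sub_le_iff.2 ⟨by linarith, by linarith⟩ : |x - y| ≤ a)
    have hhalf : (m / 2) ^ (-(1 + β)) ≤ 8 * m ^ (-(1 + β)) := by
      rw [Real.div_rpow hm0.le zero_le_two, Real.rpow_neg zero_le_two, div_inv_eq_mul, mul_comm]
      gcongr
      calc (2 : ℝ) ^ (1 + β) ≤ 2 ^ (3 : ℝ) :=
            Real.rpow_le_rpow_of_exponent_le one_le_two (by linarith)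
        _ = 8 := by norm_num
    calc |x ^ (-β) - y ^ (-β)| * (a ^ (q + 1))⁻¹ * (b ^ (q + 1))⁻¹
        ≤ (2 * a * (8 * m ^ (-(1 + β)))) * (a ^ (q + 1))⁻¹ * (b ^ (q + 1))⁻¹ := by
          gcongr
          exact hD.trans (by gcongr)
      _ = 16 * m ^ (-(1 + β)) * (a * (a ^ (q + 1))⁻¹ * (b ^ (q + 1))⁻¹) := by ring
      _ ≤ 16 * m ^ (-(1 + β)) *
            (2 ^ (q + 1) * (r ^ q)⁻¹ * ((a ^ (q + 1))⁻¹ + (b ^ (q + 1))⁻¹)) := by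
          exact mul_le_mul_of_nonneg_left (mul_inv_pow_mul_inv_pow_le ha hb hr hrab q)
            (by positivity)
      _ ≤ 16 * m ^ (-(1 + β)) * (8 ^ (q + 1) * (r ^ q)⁻¹ *
            ((a ^ (q + 1))⁻¹ + (b ^ (q + 1))⁻¹ + (x ^ (q + 1))⁻¹)) := by
          have hx' : 0 ≤ (x ^ (q + 1))⁻¹ := by positivity
          refine mul_le_mul_of_nonneg_left (mul_le_mul (by gcongr; norm_num)
            (le_add_of_nonneg_right hx') (by positivity) (by positivity)) (by positivity)
      _ = _ := by ring
  · have hD : |x ^ (-β) - y ^ (-β)| ≤ x ^ (-β) := by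
      have h1 := Real.rpow_le_rpow_of_nonpos hx0 (show x ≤ y by linarith)
        (by linarith : -β ≤ 0)
      have h2 := Real.rpow_nonneg hy0.le (-β)
      rw [abs_of_nonneg (by linarith)]
      linarith
    have hq' : (1 : ℝ) ≤ q := by exact_mod_cast hq
    calc |x ^ (-β) - y ^ (-β)| * (a ^ (q + 1))⁻¹ * (b ^ (q + 1))⁻¹
        ≤ x ^ (-β) * (a ^ (q + 1))⁻¹ * (b ^ (q + 1))⁻¹ := by gcongr
      _ ≤ 8 ^ (q + 1) * (r ^ q)⁻¹ * m ^ (-(1 + β)) * (x ^ (q + 1))⁻¹ :=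
          rpow_neg_mul_inv_pow_mul_inv_pow_le (by linarith) hx hy hz hr
            (show x ≤ m by linarith) (by linarith) (by linarith) hryz
      _ ≤ 8 ^ (q + 1) * (r ^ q)⁻¹ * m ^ (-(1 + β)) *
            ((a ^ (q + 1))⁻¹ + (b ^ (q + 1))⁻¹ + (x ^ (q + 1))⁻¹) := by
          gcongr
          exact le_add_of_nonneg_left (by positivity)
      _ ≤ _ := by
          gcongr
          rw [show (16 : ℝ) * 8 ^ (q + 1) = 15 * 8 ^ (q + 1) + 8 ^ (q + 1) by ring]
          exact le_add_of_nonneg_left (by positivity)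

lemma mul_rpow_neg_pow_six_sub {κ α x y : ℝ} (hx : 0 ≤ x) (hy : 0 ≤ y) :
    (κ * x ^ (-α)) ^ 6 - (κ * y ^ (-α)) ^ 6 =
      κ ^ 6 * (x ^ (-(6 * α)) - y ^ (-(6 * α))) := by
  have h {t : ℝ} (ht : 0 ≤ t) : (t ^ (-α)) ^ 6 = t ^ (-(6 * α)) := by
    rw [← Real.rpow_natCast, ← Real.rpow_mul ht]
    congr 1
    push_cast
    ring
  rw [mul_pow, mul_pow, h hx, h hy, mul_sub]

theorem stmt19 (d : ℕ) (hd : 5 ≤ d) (α : ℝ) (hα1 : 1 / 4 < α) (hα2 : α ≤ 1 / 3)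
    (Cd : ℝ) :
    ∃ C : ℝ, 0 < C ∧
      ∀ (κ : ℝ), 0 ≤ κ →
      ∀ (G : (Fin d → ℤ) → (Fin d → ℤ) → ℝ),
        (∀ n n' : Fin d → ℤ, |G n n'| ≤ Cd / znorm (n - n') ^ ((d : ℝ) - 2)) →
        ∀ n₁ n₃ : Fin d → ℤ,
          (Summable fun n₂ : Fin d → ℤ =>
            |((κ * znorm n₂ ^ (-α)) ^ 6 - (κ * znorm n₁ ^ (-α)) ^ 6) *
              G n₁ n₂ ^ 2 * G n₂ n₃ ^ 2|) ∧
          |G n₁ n₃ *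
              ∑' n₂ : Fin d → ℤ,
                ((κ * znorm n₂ ^ (-α)) ^ 6 - (κ * znorm n₁ ^ (-α)) ^ 6) *
                  G n₁ n₂ ^ 2 * G n₂ n₃ ^ 2|
            ≤ C * κ ^ 6 /
              (znorm (n₁ - n₃) ^ (3 * ((d : ℝ) - 2) - 1) *
                (min (znorm n₁) (znorm n₃)) ^ (1 + 6 * α)) := by
  obtain ⟨e, rfl⟩ : ∃ e, d = e + 2 := ⟨d - 2, by omega⟩
  obtain ⟨q, hq⟩ : ∃ q, 2 * e = q + 1 := ⟨2 * e - 1, by omega⟩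
  have hexp : ((e + 2 : ℕ) : ℝ) - 2 = (e : ℕ) := by push_cast; ring
  have hexp' : 3 * (((e + 2 : ℕ) : ℝ) - 2) - 1 = ((e + q : ℕ) : ℝ) := by
    have : (2 : ℝ) * e = q + 1 := by exact_mod_cast hq
    push_cast
    linarith
  have hsum : Summable fun n : Fin (e + 2) → ℤ => (znorm n ^ (q + 1))⁻¹ :=
    summable_inv_znorm_pow (by omega)
  set T := ∑' n : Fin (e + 2) → ℤ, (znorm n ^ (q + 1))⁻¹
  have hzpos (n : Fin (e + 2) → ℤ) : 0 < znorm n := zero_lt_one.trans_le (one_le_znorm n)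
  have hT0 : 0 ≤ T := tsum_nonneg fun n => inv_nonneg.2 (pow_nonneg (hzpos n).le _)
  refine ⟨16 * 8 ^ (q + 1) * (3 * T) * |Cd| ^ 5 + 1, by positivity, ?_⟩
  intro κ hκ G hG n₁ n₃
  rw [hexp']
  simp only [hexp, Real.rpow_natCast] at hG
  have hcomm (m n : Fin (e + 2) → ℤ) : znorm (m - n) = znorm (n - m) := by
    rw [← znorm_neg, neg_sub]
  have htri (m n : Fin (e + 2) → ℤ) : znorm m ≤ znorm n + znorm (m - n) := by
    simpa using znorm_add_le n (m - n)
  have hGsq (n n' : Fin (e + 2) → ℤ) :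
      G n n' ^ 2 ≤ |Cd| ^ 2 * (znorm (n - n') ^ (q + 1))⁻¹ := by
    calc G n n' ^ 2 = |G n n'| ^ 2 := (sq_abs _).symm
      _ ≤ (Cd / znorm (n - n') ^ e) ^ 2 := by gcongr; exact hG n n'
      _ = |Cd| ^ 2 * (znorm (n - n') ^ (q + 1))⁻¹ := by
        rw [sq_abs, div_pow, ← pow_mul, mul_comm e, hq, div_eq_mul_inv]
  set r := znorm (n₁ - n₃) with hr
  set m := min (znorm n₁) (znorm n₃)
  have hr0 : 0 < r := hzpos _
  have hm0 : 0 < m := lt_min (hzpos _) (hzpos _)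
  set A := κ ^ 6 * |Cd| ^ 4 * (16 * 8 ^ (q + 1) * (r ^ q)⁻¹ * m ^ (-(1 + 6 * α))) with hA
  set w : (Fin (e + 2) → ℤ) → ℝ := fun n₂ => (znorm (n₁ - n₂) ^ (q + 1))⁻¹ +
    (znorm (n₂ - n₃) ^ (q + 1))⁻¹ + (znorm n₂ ^ (q + 1))⁻¹
  have hbound (n₂ : Fin (e + 2) → ℤ) :
      |((κ * znorm n₂ ^ (-α)) ^ 6 - (κ * znorm n₁ ^ (-α)) ^ 6) *
        G n₁ n₂ ^ 2 * G n₂ n₃ ^ 2| ≤ A * w n₂ := by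
    have hab : r ≤ znorm (n₁ - n₂) + znorm (n₂ - n₃) := by
      simpa using znorm_add_le (n₁ - n₂) (n₂ - n₃)
    have hyz : r ≤ znorm n₁ + znorm n₃ := by
      simpa [sub_eq_add_neg, znorm_neg, hr] using znorm_add_le n₁ (-n₃)
    have hkey := abs_sub_mul_inv_pow_mul_inv_pow_le (β := 6 * α) (q := q) (by linarith)
      (by linarith) (by omega) (one_le_znorm n₂) (one_le_znorm n₁) (one_le_znorm n₃)
      (one_le_znorm (n₁ - n₂)) (one_le_znorm (n₂ - n₃)) (one_le_znorm (n₁ - n₃)) hab hyz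
      (by rw [hcomm]; exact htri n₂ n₁) (htri n₁ n₂) (by rw [hcomm]; exact htri n₃ n₂)
    rw [mul_rpow_neg_pow_six_sub (hzpos _).le (hzpos _).le, abs_mul, abs_mul, abs_mul,
      abs_of_nonneg (pow_nonneg hκ 6), abs_of_nonneg (sq_nonneg (G n₁ n₂)),
      abs_of_nonneg (sq_nonneg (G n₂ n₃))]
    set D := |znorm n₂ ^ (-(6 * α)) - znorm n₁ ^ (-(6 * α))|
    have ha := hzpos (n₁ - n₂)
    calc κ ^ 6 * D * G n₁ n₂ ^ 2 * G n₂ n₃ ^ 2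
        ≤ κ ^ 6 * D * (|Cd| ^ 2 * (znorm (n₁ - n₂) ^ (q + 1))⁻¹) *
            (|Cd| ^ 2 * (znorm (n₂ - n₃) ^ (q + 1))⁻¹) := by
          gcongr
          · exact hGsq n₁ n₂
          · exact hGsq n₂ n₃
      _ = κ ^ 6 * |Cd| ^ 4 *
            (D * (znorm (n₁ - n₂) ^ (q + 1))⁻¹ * (znorm (n₂ - n₃) ^ (q + 1))⁻¹) := by ring
      _ ≤ κ ^ 6 * |Cd| ^ 4 * (16 * 8 ^ (q + 1) * (r ^ q)⁻¹ * m ^ (-(1 + 6 * α)) * w n₂) :=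
          mul_le_mul_of_nonneg_left hkey (by positivity)
      _ = A * w n₂ := by ring
  have hs₁ : HasSum (fun n₂ => (znorm (n₁ - n₂) ^ (q + 1))⁻¹) T :=
    (Equiv.subLeft n₁).hasSum_iff (f := fun n => (znorm n ^ (q + 1))⁻¹) |>.2 hsum.hasSum
  have hs₂ : HasSum (fun n₂ => (znorm (n₂ - n₃) ^ (q + 1))⁻¹) T :=
    (Equiv.subRight n₃).hasSum_iff (f := fun n => (znorm n ^ (q + 1))⁻¹) |>.2 hsum.hasSum
  have hAw : HasSum (fun n₂ => A * w n₂) (A * (T + T + T)) :=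
    ((hs₁.add hs₂).add hsum.hasSum).mul_left A
  have habs := Summable.of_nonneg_of_le (fun _ => abs_nonneg _) hbound hAw.summable
  refine ⟨habs, ?_⟩
  have htsum := tsum_of_norm_bounded hAw fun n₂ => (Real.norm_eq_abs _).trans_le (hbound n₂)
  rw [Real.norm_eq_abs] at htsum
  rw [abs_mul]
  have hG₁₃ : |G n₁ n₃| ≤ |Cd| / r ^ e := (hG n₁ n₃).trans (by gcongr; exact le_abs_self Cd)
  have hmβ := Real.rpow_pos_of_pos hm0 (1 + 6 * α)
  refine (mul_le_mul hG₁₃ htsum (abs_nonneg _) (by positivity)).trans ?_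
  calc |Cd| / r ^ e * (A * (T + T + T))
      = (16 * 8 ^ (q + 1) * (3 * T) * |Cd| ^ 5) * κ ^ 6 /
          (r ^ (e + q) * m ^ (1 + 6 * α)) := by
        rw [hA, Real.rpow_neg hm0.le, pow_add]
        field_simp
        ring
    _ ≤ (16 * 8 ^ (q + 1) * (3 * T) * |Cd| ^ 5 + 1) * κ ^ 6 /
          (r ^ (e + q) * m ^ (1 + 6 * α)) := by
        gcongr
        linarith
    _ = _ := by rw [Real.rpow_natCast]
end
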